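/- arXiv:2602.23819 — 2 statements merged into one kernel-verified Lean document; each statement's English description precedes it below -/
import Mathlib

section
/- Let G_1, G_2, and H be finitely generated groups with H a subgroup of both G_1 and G_2, and let G = G_1 *_H G_2 be the amalgamated free product. If for each j ∈ {1,2} the word problem in G_j is solvable and the strong membership problem for H in G_j is solvable, then the word problem in G is solvable (with respect to the generating set S_1 ⊔ S_2, where S_j is a finite generating set of G_j). -/
noncomputable instance (priority := 50) fintypePrimcodable {α : Type*} [Fintype α] [DecidableEq α] :
    Primcodable α :=
  Primcodable.ofEquiv (Fin (Fintype.card α)) (Fintype.equivFin α)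

/-- Evaluation in `G` of a word over an alphabet `A` of generators together with formal
inverses: the letter `(a, true)` is the generator `gen a` and `(a, false)` is its inverse. -/
def evalWord {A G : Type*} [Group G] (gen : A → G) (w : List (A × Bool)) : G :=
  (w.map fun p => if p.2 then gen p.1 else (gen p.1)⁻¹).prod

/-- A group `G` has a solvable word problem with respect to a generating family `gen : A → G`
if there is an algorithm deciding whether a word over `A ⊔ A⁻¹` represents the identity. -/
def SolvableWordProblem {A G : Type*} [Primcodable A] [Group G] (gen : A → G) : Prop :=
  ComputablePred fun w : List (A × Bool) => evalWord gen w = 1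

/-- The strong membership problem for the subgroup of `G` generated by the family
`genH : B → G` is solvable with respect to the generating family `gen : A → G` of `G`:
there is an algorithm that decides whether the element represented by a word over `A ⊔ A⁻¹`
belongs to the subgroup and, if so, outputs a word over `B ⊔ B⁻¹` representing the same
element. -/
def SolvableStrongMembershipIn {A B G : Type*} [Primcodable A] [Primcodable B] [Group G]
    (gen : A → G) (genH : B → G) : Prop :=
  ∃ f : List (A × Bool) → Option (List (B × Bool)), Computable f ∧
    ∀ w : List (A × Bool),
      (evalWord gen w ∈ Subgroup.closure (Set.range genH) ↔ (f w).isSome) ∧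
      ∀ μ, f w = some μ → evalWord genH μ = evalWord gen w

section EvalWord

variable {A G : Type*} [Group G] (gen : A → G)

@[simp]
theorem evalWord_nil : evalWord gen [] = 1 := rfl

theorem evalWord_cons (p : A × Bool) (w : List (A × Bool)) :
    evalWord gen (p :: w) = evalWord gen [p] * evalWord gen w := by
  simp [evalWord]

@[simp]
theorem evalWord_append (v w : List (A × Bool)) :
    evalWord gen (v ++ w) = evalWord gen v * evalWord gen w := by
  simp [evalWord]

theorem evalWord_comp {K : Type*} [Group K] (f : G →* K) (w : List (A × Bool)) :
    evalWord (fun a => f (gen a)) w = f (evalWord gen w) := by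
  induction w with
  | nil => simp
  | cons p w ih =>
    rw [evalWord_cons, evalWord_cons gen, ih, map_mul]
    congr 1
    rcases p with ⟨a, _ | _⟩ <;> simp [evalWord]

theorem evalWord_flatMap {B : Type*} {K : Type*} [Group K] (f : K →* G) (genK : B → K)
    (s : B × Bool → List (A × Bool)) (hs : ∀ p, evalWord gen (s p) = f (evalWord genK [p]))
    (w : List (B × Bool)) : evalWord gen (w.flatMap s) = f (evalWord genK w) := by
  induction w with
  | nil => simp
  | cons p w ih =>
    rw [List.flatMap_cons, evalWord_append, ih, hs, evalWord_cons genK p w, map_mul]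

theorem evalWord_filterMap {C : Type*} (r : C → Option A) (w : List (C × Bool)) :
    evalWord gen (w.filterMap fun p => (r p.1).map fun a => (a, p.2)) =
      evalWord (fun c => (r c).elim 1 gen) w := by
  induction w with
  | nil => simp
  | cons p w ih =>
    rw [evalWord_cons, ← ih]
    cases h : r p.1 <;> simp [evalWord, h]

theorem exists_evalWord_eq (hgen : Subgroup.closure (Set.range gen) = ⊤) (g : G) :
    ∃ w, evalWord gen w = g := by
  have hg : g ∈ Subgroup.closure (Set.range gen) := hgen ▸ Subgroup.mem_top g
  induction hg using Subgroup.closure_induction_left with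
  | one => exact ⟨[], rfl⟩
  | mul_left x hx y _ ih =>
    obtain ⟨a, rfl⟩ := hx
    obtain ⟨w, rfl⟩ := ih
    exact ⟨(a, true) :: w, by simp [evalWord]⟩
  | inv_mul_cancel x hx y _ ih =>
    obtain ⟨a, rfl⟩ := hx
    obtain ⟨w, rfl⟩ := ih
    exact ⟨(a, false) :: w, by simp [evalWord]⟩

end EvalWord

section Computability

variable {α β σ : Type*} [Primcodable α] [Primcodable β] [Primcodable σ]

theorem Computable.bool_family {f : Bool → α → σ} (hf : ∀ b, Computable (f b)) :
    Computable₂ f :=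
  (Computable.cond Computable.fst ((hf true).comp Computable.snd)
    ((hf false).comp Computable.snd)).of_eq (by rintro ⟨_ | _, a⟩ <;> rfl)

theorem ComputablePred.comp_computable {p : β → Prop} {f : α → β} (hp : ComputablePred p)
    (hf : Computable f) : ComputablePred fun a => p (f a) := by
  obtain ⟨_, h⟩ := hp
  exact ⟨fun a => inferInstance, h.comp hf⟩

theorem ComputablePred.and_computable {p q : α → Prop} (hp : ComputablePred p)
    (hq : ComputablePred q) : ComputablePred fun a => p a ∧ q a := by
  obtain ⟨_, hp⟩ := hp
  obtain ⟨_, hq⟩ := hq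
  exact ⟨fun a => inferInstance, (Primrec.and.to_comp.comp hp hq).of_eq fun a => by simp⟩

theorem Computable.list_foldl_const {f : σ → α → σ} (hf : Computable₂ f) (s : σ) :
    Computable fun l : List α => l.foldl f s := by
  have hstep : Computable₂ fun (l : List α) (q : ℕ × σ) =>
      (Option.casesOn l[q.1]? q.2 (fun a => f q.2 a) : σ) :=
    Computable.option_casesOn
      (Computable.list_getElem?.comp Computable.fst (Computable.fst.comp Computable.snd))
      (Computable.snd.comp Computable.snd)
      (hf.comp (Computable.snd.comp (Computable.snd.comp Computable.fst)) Computable.snd)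
  refine (Computable.nat_rec Computable.list_length (Computable.const s) hstep).of_eq fun l => ?_
  have key : ∀ n ≤ l.length, (Nat.rec (motive := fun _ => σ) s
      (fun y IH => (Option.casesOn l[y]? IH (fun a => f IH a) : σ)) n) = (l.take n).foldl f s := by
    intro n
    induction n with
    | zero => simp
    | succ n ih =>
      intro hn
      have hn' : n < l.length := hn
      dsimp only
      rw [ih hn'.le, List.take_add_one, List.getElem?_eq_getElem hn']
      simp only [Option.toList_some, List.foldl_append, List.foldl_cons, List.foldl_nil]
  simpa using key l.length le_rfl

theorem Computable.list_foldr_const {f : α → σ → σ} (hf : Computable₂ f) (s : σ) :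
    Computable fun l : List α => l.foldr f s :=
  ((Computable.list_foldl_const (f := fun s a => f a s)
    (hf.comp Computable.snd Computable.fst) s).comp Computable.list_reverse).of_eq
    fun l => by simp

end Computability

namespace AmalgamReduction

/-- A word in the generators of `H`, followed by a stack of syllables; each syllable is a word
marked by the factor in which it is to be read. -/
abbrev State (B C : Type*) := List (B × Bool) × List (Bool × List (C × Bool))

section Algorithm

variable {B C : Type*}

/-- Remove the topmost syllable of the stack if it belongs to the factor `b`. -/
def pop (b : Bool) (st : List (Bool × List (C × Bool))) :
    List (C × Bool) × List (Bool × List (C × Bool)) :=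
  List.casesOn st ([], []) fun p rest => bif p.1 == b then (p.2, rest) else ([], p :: rest)

@[simp]
theorem pop_nil (b : Bool) : pop (C := C) b [] = ([], []) := rfl

@[simp]
theorem pop_cons_self (b : Bool) (w : List (C × Bool)) (st : List (Bool × List (C × Bool))) :
    pop b ((b, w) :: st) = (w, st) := by
  simp [pop]

theorem pop_cons_of_ne {b b' : Bool} (hb : b' ≠ b) (w : List (C × Bool))
    (st : List (Bool × List (C × Bool))) : pop b ((b', w) :: st) = ([], (b', w) :: st) := by
  simp [pop, beq_eq_false_iff_ne.2 hb]

/-- The word obtained by multiplying a letter from the left to the `H`-part of a state and to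
the syllable that can be merged with it. -/
def headWord (tag : C → Bool) (sub : Bool → B × Bool → List (C × Bool)) (x : C × Bool)
    (S : State B C) : List (C × Bool) :=
  x :: (S.1.flatMap (sub (tag x.1)) ++ (pop (tag x.1) S.2).1)

/-- Left multiplication of a state by a letter. -/
def step (tag : C → Bool) (sub : Bool → B × Bool → List (C × Bool))
    (mem : Bool → List (C × Bool) → Option (List (B × Bool))) (x : C × Bool)
    (S : State B C) : State B C :=
  Option.casesOn (mem (tag x.1) (headWord tag sub x S))
    ([], (tag x.1, headWord tag sub x S) :: (pop (tag x.1) S.2).2)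
    fun μ => (μ, (pop (tag x.1) S.2).2)

variable [Primcodable B] [Primcodable C]

theorem primrec_pop : Primrec₂ (pop (C := C)) := by
  have hp : Primrec fun q : (Bool × List (Bool × List (C × Bool))) ×
      (Bool × List (C × Bool)) × List (Bool × List (C × Bool)) => q.2.1 :=
    Primrec.fst.comp Primrec.snd
  have hrest : Primrec fun q : (Bool × List (Bool × List (C × Bool))) ×
      (Bool × List (C × Bool)) × List (Bool × List (C × Bool)) => q.2.2 :=
    Primrec.snd.comp Primrec.snd
  have hmerge : Primrec₂ fun (a : Bool × List (Bool × List (C × Bool)))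
      (q : (Bool × List (C × Bool)) × List (Bool × List (C × Bool))) =>
      (bif q.1.1 == a.1 then (q.1.2, q.2) else ([], q.1 :: q.2) :
        List (C × Bool) × List (Bool × List (C × Bool))) :=
    Primrec.cond (Primrec.beq.comp (Primrec.fst.comp hp) (Primrec.fst.comp Primrec.fst))
      (Primrec.pair (Primrec.snd.comp hp) hrest)
      (Primrec.pair (Primrec.const []) (Primrec.list_cons.comp hp hrest))
  exact (Primrec.list_casesOn Primrec.snd (Primrec.const ([], [])) hmerge).of_eq fun _ => rfl

variable {tag : C → Bool} {sub : Bool → B × Bool → List (C × Bool)}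
  {mem : Bool → List (C × Bool) → Option (List (B × Bool))}

theorem primrec_pop_step (htag : Primrec tag) :
    Primrec₂ fun (x : C × Bool) (S : State B C) => pop (tag x.1) S.2 :=
  primrec_pop.comp (htag.comp (Primrec.fst.comp Primrec.fst)) (Primrec.snd.comp Primrec.snd)

theorem primrec_headWord (htag : Primrec tag) (hsub : Primrec₂ sub) :
    Primrec₂ (headWord tag sub) :=
  Primrec.list_cons.comp Primrec.fst (Primrec.list_append.comp
    (Primrec.list_flatMap (Primrec.fst.comp Primrec.snd)
      (hsub.comp (htag.comp (Primrec.fst.comp (Primrec.fst.comp Primrec.fst))) Primrec.snd))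
    (Primrec.fst.comp (primrec_pop_step htag)))

theorem computable_step (htag : Primrec tag) (hsub : Primrec₂ sub) (hmem : Computable₂ mem) :
    Computable₂ (step tag sub mem) := by
  have hb : Primrec fun q : (C × Bool) × State B C => tag q.1.1 :=
    htag.comp (Primrec.fst.comp Primrec.fst)
  have hw : Primrec fun q : (C × Bool) × State B C => headWord tag sub q.1 q.2 :=
    primrec_headWord htag hsub
  have hrest : Primrec fun q : (C × Bool) × State B C => (pop (tag q.1.1) q.2.2).2 :=
    Primrec.snd.comp (primrec_pop_step htag)
  exact Computable.option_casesOn (hmem.comp hb.to_comp hw.to_comp)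
    (Primrec.pair (Primrec.const [])
      (Primrec.list_cons.comp (Primrec.pair hb hw) hrest)).to_comp
    (Computable.pair Computable.snd (hrest.to_comp.comp Computable.fst))

end Algorithm

section Correctness

open Monoid PushoutI

variable {G : Bool → Type*} [∀ b, Group (G b)] {H : Type*} [Group H] (φ : ∀ b, H →* G b)
  {B C : Type*} (gen : ∀ b, C → G b) (genH : B → H)

/-- The product of a stack of syllables in the amalgamated product. -/
def stackVal (st : List (Bool × List (C × Bool))) : PushoutI φ :=
  (st.map fun p => PushoutI.of (φ := φ) p.1 (evalWord (gen p.1) p.2)).prod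

/-- The element of the amalgamated product represented by a state. -/
def stateVal (S : State B C) : PushoutI φ :=
  PushoutI.base φ (evalWord genH S.1) * stackVal φ gen S.2

/-- A stack is reduced if consecutive syllables belong to different factors and no syllable
lies in the amalgamated subgroup. -/
def IsReduced (st : List (Bool × List (C × Bool))) : Prop :=
  st.IsChain (fun p q => p.1 ≠ q.1) ∧ ∀ p ∈ st, evalWord (gen p.1) p.2 ∉ (φ p.1).range

variable {φ gen}

theorem IsReduced.tail {p : Bool × List (C × Bool)} {st : List (Bool × List (C × Bool))}
    (h : IsReduced φ gen (p :: st)) : IsReduced φ gen st :=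
  ⟨h.1.tail, fun q hq => h.2 q (List.mem_cons_of_mem _ hq)⟩

theorem of_mul_stackVal_pop (b : Bool) (st : List (Bool × List (C × Bool))) :
    PushoutI.of (φ := φ) b (evalWord (gen b) (pop b st).1) * stackVal φ gen (pop b st).2 =
      stackVal φ gen st := by
  rcases st with _ | ⟨⟨b', w⟩, rest⟩
  · simp
  · by_cases hb : b' = b
    · subst hb
      simp [stackVal]
    · simp [pop_cons_of_ne hb]

theorem IsReduced.pop {st : List (Bool × List (C × Bool))} (h : IsReduced φ gen st) (b : Bool) :
    IsReduced φ gen (pop b st).2 ∧ ∀ p ∈ (AmalgamReduction.pop b st).2.head?, b ≠ p.1 := by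
  rcases st with _ | ⟨⟨b', w⟩, rest⟩
  · exact ⟨h, by simp⟩
  · by_cases hb : b' = b
    · subst hb
      rw [pop_cons_self]
      exact ⟨h.tail, (List.isChain_cons.1 h.1).1⟩
    · rw [pop_cons_of_ne hb]
      refine ⟨h, fun p hp => ?_⟩
      obtain rfl : (b', w) = p := Option.some_injective _ hp
      exact Ne.symm hb

/-- A reduced stack lies in the amalgamated subgroup only if it is empty. -/
theorem IsReduced.eq_nil (hφ : ∀ b, Function.Injective (φ b))
    {st : List (Bool × List (C × Bool))} (h : IsReduced φ gen st)
    (hst : stackVal φ gen st ∈ (PushoutI.base φ).range) : st = [] := by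
  let w : CoprodI.Word G :=
    { toList := st.map fun p => ⟨p.1, evalWord (gen p.1) p.2⟩
      ne_one := by
        simp only [List.mem_map]
        rintro _ ⟨p, hp, rfl⟩ hone
        refine h.2 p hp ?_
        rw [show evalWord (gen p.1) p.2 = 1 from hone]
        exact one_mem _
      chain_ne := (List.isChain_map _).2 h.1 }
  have hw : PushoutI.Reduced φ w := by
    simp only [PushoutI.Reduced, w, List.mem_map]
    rintro _ ⟨p, hp, rfl⟩
    exact h.2 p hp
  have hprod : PushoutI.ofCoprodI w.prod = stackVal φ gen st := by
    simp [CoprodI.Word.prod, w, stackVal, map_list_prod, Function.comp_def]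
  have hempty := congrArg CoprodI.Word.toList (hw.eq_empty_of_mem_range hφ (hprod ▸ hst))
  simpa [w, CoprodI.Word.empty] using hempty

theorem IsReduced.stateVal_eq_one_iff (hφ : ∀ b, Function.Injective (φ b)) {S : State B C}
    (h : IsReduced φ gen S.2) :
    stateVal φ gen genH S = 1 ↔ S.2 = [] ∧ evalWord genH S.1 = 1 := by
  constructor
  · intro hS
    have hnil : S.2 = [] := by
      refine h.eq_nil hφ ⟨(evalWord genH S.1)⁻¹, ?_⟩
      rw [map_inv]
      exact inv_eq_of_mul_eq_one_right hS
    refine ⟨hnil, PushoutI.base_injective hφ ?_⟩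
    simpa [stateVal, hnil, stackVal] using hS
  · rintro ⟨hnil, hone⟩
    simp [stateVal, hnil, hone, stackVal]

variable {genH} {tag : C → Bool} {sub : Bool → B × Bool → List (C × Bool)}
  {mem : Bool → List (C × Bool) → Option (List (B × Bool))}

theorem of_headWord_mul (hsub : ∀ b p, evalWord (gen b) (sub b p) = φ b (evalWord genH [p]))
    (x : C × Bool) (S : State B C) :
    PushoutI.of (φ := φ) (tag x.1) (evalWord (gen (tag x.1)) (headWord tag sub x S)) *
        stackVal φ gen (pop (tag x.1) S.2).2 =
      PushoutI.of (φ := φ) (tag x.1) (evalWord (gen (tag x.1)) [x]) * stateVal φ gen genH S := by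
  rw [headWord, evalWord_cons, evalWord_append,
    evalWord_flatMap (gen (tag x.1)) (φ (tag x.1)) genH _ (hsub _), map_mul, map_mul,
    PushoutI.of_apply_eq_base, mul_assoc, mul_assoc, of_mul_stackVal_pop, stateVal]

theorem step_spec (hsub : ∀ b p, evalWord (gen b) (sub b p) = φ b (evalWord genH [p]))
    (hmem : ∀ b w, (evalWord (gen b) w ∈ (φ b).range ↔ (mem b w).isSome) ∧
      ∀ μ, mem b w = some μ → φ b (evalWord genH μ) = evalWord (gen b) w)
    (x : C × Bool) {S : State B C} (hS : IsReduced φ gen S.2) :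
    IsReduced φ gen (step tag sub mem x S).2 ∧
      stateVal φ gen genH (step tag sub mem x S) =
        PushoutI.of (φ := φ) (tag x.1) (evalWord (gen (tag x.1)) [x]) *
          stateVal φ gen genH S := by
  obtain ⟨hpop, hhead⟩ := hS.pop (tag x.1)
  obtain ⟨hiff, hval⟩ := hmem (tag x.1) (headWord tag sub x S)
  rw [← of_headWord_mul hsub]
  cases hm : mem (tag x.1) (headWord tag sub x S) with
  | some μ =>
    have hstep : step tag sub mem x S = (μ, (AmalgamReduction.pop (tag x.1) S.2).2) := by
      simp [step, hm]
    rw [hstep]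
    refine ⟨hpop, ?_⟩
    rw [← hval μ hm, PushoutI.of_apply_eq_base, stateVal]
  | none =>
    have hstep : step tag sub mem x S = ([], (tag x.1, headWord tag sub x S) ::
        (AmalgamReduction.pop (tag x.1) S.2).2) := by
      simp [step, hm]
    rw [hstep]
    refine ⟨⟨List.isChain_cons.2 ⟨hhead, hpop.1⟩, ?_⟩, by simp [stateVal, stackVal]⟩
    rw [List.forall_mem_cons]
    exact ⟨by simp [hiff, hm], hpop.2⟩

theorem foldr_step_spec (hsub : ∀ b p, evalWord (gen b) (sub b p) = φ b (evalWord genH [p]))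
    (hmem : ∀ b w, (evalWord (gen b) w ∈ (φ b).range ↔ (mem b w).isSome) ∧
      ∀ μ, mem b w = some μ → φ b (evalWord genH μ) = evalWord (gen b) w)
    (w : List (C × Bool)) :
    IsReduced φ gen (w.foldr (step tag sub mem) ([], [])).2 ∧
      stateVal φ gen genH (w.foldr (step tag sub mem) ([], [])) =
        evalWord (fun c => PushoutI.of (φ := φ) (tag c) (gen (tag c) c)) w := by
  induction w with
  | nil => simp [IsReduced, stateVal, stackVal]
  | cons x w ih =>
    obtain ⟨hred, hval⟩ := step_spec (tag := tag) hsub hmem x ih.1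
    refine ⟨hred, ?_⟩
    rw [List.foldr_cons, hval, ih.2, evalWord_cons _ x w]
    congr 1
    rcases x with ⟨c, _ | _⟩ <;> simp [evalWord]

/-- The amalgamated product has a solvable word problem when both factors are generated by
families indexed by a common alphabet. -/
theorem solvableWordProblem [Primcodable B] [Finite B] [Primcodable C]
    (hφ : ∀ b, Function.Injective (φ b)) (htag : Primrec tag)
    (hgen : ∀ b, Subgroup.closure (Set.range (gen b)) = ⊤)
    (hgenH : Subgroup.closure (Set.range genH) = ⊤)
    (hwp : SolvableWordProblem (gen true))
    (hsm : ∀ b, SolvableStrongMembershipIn (gen b) (fun x => φ b (genH x))) :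
    SolvableWordProblem fun c => PushoutI.of (φ := φ) (tag c) (gen (tag c) c) := by
  choose sub hsub using fun (b : Bool) (p : B × Bool) =>
    exists_evalWord_eq (gen b) (hgen b) (φ b (evalWord genH [p]))
  choose mem hmem_comp hmem using hsm
  have hrange (b : Bool) : Subgroup.closure (Set.range fun x => φ b (genH x)) = (φ b).range := by
    rw [Set.range_comp' (φ b) genH, ← MonoidHom.map_closure, hgenH, MonoidHom.range_eq_map]
  simp only [hrange, evalWord_comp] at hmem
  have hsub_prim : Primrec₂ sub := Primrec.dom_finite _
  have hcomp : Computable fun w : List (C × Bool) => w.foldr (step tag sub mem) ([], []) :=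
    Computable.list_foldr_const
      (computable_step htag hsub_prim (Computable.bool_family hmem_comp)) _
  have hflat : Computable fun h : List (B × Bool) => h.flatMap (sub true) :=
    (Primrec.list_flatMap Primrec.id
      (hsub_prim.comp (Primrec.const true) Primrec.snd).to₂).to_comp
  have hnil : ComputablePred fun st : List (Bool × List (C × Bool)) => st.length = 0 :=
    ⟨inferInstance,
      ((PrimrecRel.decide Primrec.eq).comp Primrec.list_length (Primrec.const 0)).to_comp⟩
  refine ((hnil.comp_computable (Computable.snd.comp hcomp)).and_computable
    (hwp.comp_computable (hflat.comp (Computable.fst.comp hcomp)))).of_eq fun w => ?_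
  obtain ⟨hred, hval⟩ := foldr_step_spec (tag := tag) hsub hmem w
  rw [← hval, hred.stateVal_eq_one_iff genH hφ, List.length_eq_zero_iff,
    evalWord_flatMap (gen true) (φ true) genH _ (hsub true), map_eq_one_iff _ (hφ true)]

end Correctness

section Alphabet

variable {A : Bool → Type*}

/-- The factor a letter belongs to. -/
def sumTag (c : A true ⊕ A false) : Bool := c.isLeft

/-- The letter of the factor `b` given by a letter of the joint alphabet, if any. -/
def sumProj : ∀ b, A true ⊕ A false → Option (A b)
  | true => Sum.getLeft?
  | false => Sum.getRight?

theorem sumProj_surjective (b : Bool) (a : A b) : ∃ c, sumProj b c = some a := by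
  cases b
  · exact ⟨Sum.inr a, rfl⟩
  · exact ⟨Sum.inl a, rfl⟩

end Alphabet

end AmalgamReduction

section ChangeOfAlphabet

variable {A C G : Type*} [Primcodable A] [Primcodable C] [Group G] {gen : A → G}

theorem computable_filterMap_letters [Finite C] (r : C → Option A) :
    Computable fun w : List (C × Bool) =>
      w.filterMap fun p => (r p.1).map fun a => (a, p.2) :=
  (Primrec.listFilterMap Primrec.id ((Primrec.dom_finite
    fun p : C × Bool => (r p.1).map fun a => (a, p.2)).comp Primrec.snd).to₂).to_comp

theorem SolvableWordProblem.extend [Finite C] (h : SolvableWordProblem gen) (r : C → Option A) :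
    SolvableWordProblem fun c => (r c).elim 1 gen :=
  (h.comp_computable (computable_filterMap_letters r)).of_eq fun w => by
    rw [evalWord_filterMap]

theorem SolvableStrongMembershipIn.extend [Finite C] {B : Type*} [Primcodable B] {genH : B → G}
    (h : SolvableStrongMembershipIn gen genH) (r : C → Option A) :
    SolvableStrongMembershipIn (fun c => (r c).elim 1 gen) genH := by
  obtain ⟨f, hf, hspec⟩ := h
  refine ⟨_, hf.comp (computable_filterMap_letters r), fun w => ?_⟩
  rw [← evalWord_filterMap]
  exact hspec _

end ChangeOfAlphabet

open Monoid in
/-- **Proposition 2.18.** Let `G = G₁ *_H G₂` with `G₁`, `G₂`, `H` finitely generated. If for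
each `j ∈ {1,2}` the word problem in `G_j` is solvable and the strong membership problem for `H`
in `G_j` is solvable, then the word problem in `G` is solvable (with respect to the generating
set `S₁ ⊔ S₂`). -/
theorem amalgam_word_problem {G : Bool → Type*} [∀ b, Group (G b)]
    {H : Type*} [Group H] (φ : ∀ b, H →* G b) (hφ : ∀ b, Function.Injective (φ b))
    {A : Bool → Type*} [∀ b, Fintype (A b)] [∀ b, DecidableEq (A b)]
    {B : Type*} [Fintype B] [DecidableEq B]
    (gen : ∀ b, A b → G b) (hgen : ∀ b, Subgroup.closure (Set.range (gen b)) = ⊤)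
    (genH : B → H) (hgenH : Subgroup.closure (Set.range genH) = ⊤)
    (hwp : ∀ b, SolvableWordProblem (gen b))
    (hsm : ∀ b, SolvableStrongMembershipIn (gen b) (fun x => φ b (genH x))) :
    SolvableWordProblem
      (Sum.elim (fun x => PushoutI.of (φ := φ) true (gen true x))
        (fun x => PushoutI.of (φ := φ) false (gen false x))) := by
  have hgen' (b : Bool) : Subgroup.closure (Set.range fun c =>
      (AmalgamReduction.sumProj (A := A) b c).elim 1 (gen b)) = ⊤ := by
    rw [eq_top_iff, ← hgen b]
    refine Subgroup.closure_mono ?_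
    rintro _ ⟨a, rfl⟩
    obtain ⟨c, hc⟩ := AmalgamReduction.sumProj_surjective b a
    exact ⟨c, by simp [hc]⟩
  have h := AmalgamReduction.solvableWordProblem (φ := φ) (tag := AmalgamReduction.sumTag) hφ
    (Primrec.dom_finite _) hgen' hgenH ((hwp true).extend _) fun b => (hsm b).extend _
  convert h using 1
  funext c
  cases c <;> rfl
end

section
/- Let Γ be a Coxeter graph with vertex set S and let X ⊆ S. Then Φ[Γ_X] = V_X ∩ Φ[Γ]: a root of Φ[Γ] lies in the root system of Γ_X if and only if it lies in the subspace V_X spanned by {α_x | x ∈ X}. -/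
/-- The coefficient `⟨α_s, α_t⟩` of the canonical bilinear form: `-2 cos (π / m_{s,t})` if
`m_{s,t} ≠ ∞` and `-2` if `m_{s,t} = ∞` (recall `M s t = 0` encodes `∞`). -/
noncomputable def bilinCoeff {S : Type*} (M : CoxeterMatrix S) (s t : S) : ℝ :=
  if M s t = 0 then -2 else -2 * Real.cos (Real.pi / (M s t))

/-- The canonical symmetric bilinear form on `V = ⊕_{s ∈ S} ℝ α_s`, identified with `S → ℝ`. -/
noncomputable def canonicalForm {S : Type*} [Fintype S] (M : CoxeterMatrix S) (v w : S → ℝ) : ℝ :=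
  ∑ s, ∑ t, v s * w t * bilinCoeff M s t

/-- The simple root `α_s`, as an element of `S → ℝ`. -/
noncomputable def simpleRoot {S : Type*} [DecidableEq S] (s : S) : S → ℝ :=
  Pi.single s 1

/-- The action of the generator `s` in the canonical representation:
`v ↦ v - ⟨v, α_s⟩ α_s`. -/
noncomputable def simpleReflection {S : Type*} [Fintype S] [DecidableEq S] (M : CoxeterMatrix S)
    (s : S) : Function.End (S → ℝ) :=
  fun v => v - canonicalForm M v (simpleRoot s) • simpleRoot s

open CoxeterSystem

/-- `canonicalForm`, bundled as a bilinear form. -/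
noncomputable def canonicalBilin {S : Type*} [Fintype S] [DecidableEq S] (M : CoxeterMatrix S) :
    LinearMap.BilinForm ℝ (S → ℝ) :=
  Matrix.toBilin' (Matrix.of (bilinCoeff M))

lemma canonicalForm_eq_canonicalBilin {S : Type*} [Fintype S] [DecidableEq S]
    (M : CoxeterMatrix S) (v w : S → ℝ) : canonicalForm M v w = canonicalBilin M v w := by
  simp only [canonicalForm, canonicalBilin, Matrix.toBilin'_apply, Matrix.of_apply]
  exact Finset.sum_congr rfl fun _ _ => Finset.sum_congr rfl fun _ _ => by ring

lemma canonicalBilin_simpleRoot {S : Type*} [Fintype S] [DecidableEq S]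
    (M : CoxeterMatrix S) (s t : S) :
    canonicalBilin M (simpleRoot s) (simpleRoot t) = bilinCoeff M s t :=
  Matrix.toBilin'_single _ _ _

lemma bilinCoeff_comm {S : Type*} (M : CoxeterMatrix S) (s t : S) :
    bilinCoeff M s t = bilinCoeff M t s := by
  simp only [bilinCoeff, M.symmetric s t]

lemma bilinCoeff_self {S : Type*} (M : CoxeterMatrix S) (s : S) : bilinCoeff M s s = 2 := by
  simp [bilinCoeff]

lemma canonicalBilin_comm {S : Type*} [Fintype S] [DecidableEq S]
    (M : CoxeterMatrix S) (v w : S → ℝ) : canonicalBilin M v w = canonicalBilin M w v := by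
  simp only [canonicalBilin, Matrix.toBilin'_apply, Matrix.of_apply]
  rw [Finset.sum_comm]
  refine Finset.sum_congr rfl fun s _ => Finset.sum_congr rfl fun t _ => ?_
  rw [bilinCoeff_comm]
  ring

/-- `simpleReflection`, bundled as a linear map. -/
noncomputable def simpleReflectionLinear {S : Type*} [Fintype S] [DecidableEq S]
    (M : CoxeterMatrix S) (s : S) : (S → ℝ) →ₗ[ℝ] (S → ℝ) :=
  LinearMap.id - ((canonicalBilin M).flip (simpleRoot s)).smulRight (simpleRoot s)

lemma simpleReflection_apply {S : Type*} [Fintype S] [DecidableEq S]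
    (M : CoxeterMatrix S) (s : S) (v : S → ℝ) :
    simpleReflection M s v = v - canonicalBilin M v (simpleRoot s) • simpleRoot s := by
  simp only [simpleReflection, canonicalForm_eq_canonicalBilin]

lemma coe_simpleReflectionLinear {S : Type*} [Fintype S] [DecidableEq S]
    (M : CoxeterMatrix S) (s : S) : ⇑(simpleReflectionLinear M s) = simpleReflection M s := by
  funext v
  rw [simpleReflection_apply]
  simp [simpleReflectionLinear]

lemma simpleReflection_simpleRoot {S : Type*} [Fintype S] [DecidableEq S]
    (M : CoxeterMatrix S) (s t : S) :
    simpleReflection M s (simpleRoot t) = simpleRoot t - bilinCoeff M t s • simpleRoot s := by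
  rw [simpleReflection_apply, canonicalBilin_simpleRoot]

lemma simpleReflection_simpleRoot_self {S : Type*} [Fintype S] [DecidableEq S]
    (M : CoxeterMatrix S) (s : S) : simpleReflection M s (simpleRoot s) = -simpleRoot s := by
  rw [simpleReflection_simpleRoot, bilinCoeff_self]
  module

lemma canonicalBilin_simpleReflection_self {S : Type*} [Fintype S] [DecidableEq S]
    (M : CoxeterMatrix S) (s : S) (v : S → ℝ) :
    canonicalBilin M (simpleReflection M s v) (simpleReflection M s v) =
      canonicalBilin M v v := by
  simp only [simpleReflection_apply, map_sub, map_smul, LinearMap.sub_apply,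
    LinearMap.smul_apply, smul_eq_mul, canonicalBilin_simpleRoot, bilinCoeff_self,
    canonicalBilin_comm M (simpleRoot s) v]
  ring

lemma simpleReflection_apply_of_ne {S : Type*} [Fintype S] [DecidableEq S]
    (M : CoxeterMatrix S) {s t : S} (h : t ≠ s) (v : S → ℝ) :
    simpleReflection M s v t = v t := by
  simp [simpleReflection_apply, simpleRoot, h]

/-- The coefficients of the roots of a dihedral group: Chebyshev polynomials of the second kind,
shifted by one, evaluated at `d / 2`. -/
def dihedralCoeff (d : ℝ) : ℕ → ℝ
  | 0 => 0
  | 1 => 1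
  | k + 2 => d * dihedralCoeff d (k + 1) - dihedralCoeff d k

lemma dihedralCoeff_two (k : ℕ) : dihedralCoeff 2 k = k := by
  induction k using Nat.twoStepInduction with
  | zero => simp [dihedralCoeff]
  | one => simp [dihedralCoeff]
  | more k h₀ h₁ => rw [dihedralCoeff, h₀, h₁]; push_cast; ring

lemma sin_mul_dihedralCoeff (θ : ℝ) (k : ℕ) :
    Real.sin θ * dihedralCoeff (2 * Real.cos θ) k = Real.sin (k * θ) := by
  induction k using Nat.twoStepInduction with
  | zero => simp [dihedralCoeff]
  | one => simp [dihedralCoeff]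
  | more k h₀ h₁ =>
    have h₂ : Real.sin ((k + 2 : ℕ) * θ) =
        2 * Real.cos θ * Real.sin ((k + 1 : ℕ) * θ) - Real.sin (k * θ) := by
      have e₁ : ((k + 2 : ℕ) : ℝ) * θ = (k + 1 : ℕ) * θ + θ := by push_cast; ring
      have e₂ : (k : ℝ) * θ = (k + 1 : ℕ) * θ - θ := by push_cast; ring
      rw [e₁, e₂, Real.sin_add, Real.sin_sub]
      ring
    rw [h₂, ← h₀, ← h₁, dihedralCoeff]
    ring

lemma dihedralCoeff_nonneg {S : Type*} (M : CoxeterMatrix S) {s t : S} (hst : s ≠ t) {k : ℕ}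
    (hk : M s t ≠ 0 → k ≤ M s t) : 0 ≤ dihedralCoeff (-bilinCoeff M s t) k := by
  by_cases h : M s t = 0
  · rw [bilinCoeff, if_pos h, neg_neg, dihedralCoeff_two]
    positivity
  · have hm : (2 : ℝ) ≤ M s t := by
      have := M.off_diagonal s t hst
      exact_mod_cast (by lia : 2 ≤ M s t)
    have hk' : (k : ℝ) ≤ M s t := by exact_mod_cast hk h
    have hsin : 0 < Real.sin (Real.pi / M s t) := by
      apply Real.sin_pos_of_pos_of_lt_pi (by positivity)
      rw [div_lt_iff₀ (by linarith)]
      nlinarith [Real.pi_pos]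
    have hsin' : 0 ≤ Real.sin (k * (Real.pi / M s t)) := by
      apply Real.sin_nonneg_of_nonneg_of_le_pi (by positivity)
      rw [mul_div_assoc', div_le_iff₀ (by linarith)]
      nlinarith [Real.pi_pos]
    rw [bilinCoeff, if_neg h, neg_mul, neg_neg]
    rw [← sin_mul_dihedralCoeff] at hsin'
    exact nonneg_of_mul_nonneg_right hsin' hsin

/-- An element without the right descent `s` factors, with additive lengths, as an element without
the right descents `s` and `t` times an alternating word in `s` and `t`. -/
lemma CoxeterSystem.exists_eq_mul_alternatingWord {B W : Type*} [Group W] {M : CoxeterMatrix B}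
    (cs : CoxeterSystem M W) (s t : B) (w : W) (hs : ¬cs.IsRightDescent w s) :
    ∃ (v : W) (k : ℕ), w = v * cs.wordProd (alternatingWord s t k) ∧
      cs.length w = cs.length v + k ∧ ¬cs.IsRightDescent v s ∧ ¬cs.IsRightDescent v t := by
  induction hn : cs.length w using Nat.strong_induction_on generalizing w s t with
  | _ n ih =>
    by_cases ht : cs.IsRightDescent w t
    · have hlen := cs.isRightDescent_iff.1 ht
      obtain ⟨v, k, hv, hl, h₁, h₂⟩ := ih (cs.length (w * cs.simple t)) (by lia) t s
        (w * cs.simple t) (cs.isRightDescent_iff_not_isRightDescent_mul.1 ht) rfl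
      refine ⟨v, k + 1, ?_, by lia, h₂, h₁⟩
      rw [alternatingWord_succ, wordProd_concat, ← mul_assoc, ← hv,
        simple_mul_simple_cancel_right]
    · exact ⟨w, 0, by simp [alternatingWord], by simpa using hn.symm, hs, ht⟩

/-- Every element is the product of an element of the parabolic subgroup of `X` and an element
without left descents in `X`. -/
lemma CoxeterSystem.exists_eq_parabolic_mul {B W : Type*} [Group W] {M : CoxeterMatrix B}
    (cs : CoxeterSystem M W) (X : Set B) (w : W) :
    ∃ u ∈ Subgroup.closure (cs.simple '' X), ∃ v : W, w = u * v ∧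
      ∀ x ∈ X, ¬cs.IsLeftDescent v x := by
  induction hn : cs.length w using Nat.strong_induction_on generalizing w with
  | _ n ih =>
    by_cases h : ∃ x ∈ X, cs.IsLeftDescent w x
    · obtain ⟨x, hx, hd⟩ := h
      obtain ⟨u, hu, v, hv, hX⟩ := ih _ (hn ▸ hd) (cs.simple x * w) rfl
      refine ⟨cs.simple x * u, mul_mem (Subgroup.subset_closure ⟨x, hx, rfl⟩) hu, v, ?_, hX⟩
      rw [mul_assoc, ← hv, simple_mul_simple_cancel_left]
    · push Not at h
      exact ⟨1, one_mem _, w, by simp, h⟩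

section Representation

variable {S : Type*} {M : CoxeterMatrix S} {ρ : M.Group →* Function.End (S → ℝ)}

lemma rep_mul_apply (w₁ w₂ : M.Group) (v : S → ℝ) : ρ (w₁ * w₂) v = ρ w₁ (ρ w₂ v) := by
  rw [map_mul]
  rfl

lemma rep_inv_apply_rep (w : M.Group) (v : S → ℝ) : ρ w⁻¹ (ρ w v) = v := by
  rw [← rep_mul_apply, inv_mul_cancel, map_one]
  rfl

lemma rep_apply_rep_inv (w : M.Group) (v : S → ℝ) : ρ w (ρ w⁻¹ v) = v := by
  rw [← rep_mul_apply, mul_inv_cancel, map_one]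
  rfl

variable [Fintype S] [DecidableEq S]

lemma exists_linearMap_eq_rep (hρ : ∀ s : S, ρ (M.simple s) = simpleReflection M s)
    (w : M.Group) : ∃ L : (S → ℝ) →ₗ[ℝ] (S → ℝ), ⇑L = ρ w := by
  induction w using M.toCoxeterSystem.simple_induction with
  | simple s => exact ⟨simpleReflectionLinear M s, by
      rw [coe_simpleReflectionLinear, CoxeterMatrix.toCoxeterSystem_simple, hρ]⟩
  | one => exact ⟨LinearMap.id, by rw [map_one]; rfl⟩
  | mul w₁ w₂ h₁ h₂ =>
    obtain ⟨L₁, h₁⟩ := h₁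
    obtain ⟨L₂, h₂⟩ := h₂
    exact ⟨L₁ ∘ₗ L₂, by rw [map_mul, LinearMap.coe_comp, h₁, h₂]; rfl⟩

lemma canonicalBilin_rep_self (hρ : ∀ s : S, ρ (M.simple s) = simpleReflection M s)
    (w : M.Group) (v : S → ℝ) :
    canonicalBilin M (ρ w v) (ρ w v) = canonicalBilin M v v := by
  induction w using M.toCoxeterSystem.simple_induction generalizing v with
  | simple s =>
    rw [CoxeterMatrix.toCoxeterSystem_simple, hρ, canonicalBilin_simpleReflection_self]
  | one => rw [map_one]; rfl
  | mul w₁ w₂ h₁ h₂ => rw [rep_mul_apply, h₁, h₂]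

lemma rep_mul_simple_simpleRoot (hρ : ∀ s : S, ρ (M.simple s) = simpleReflection M s)
    (w : M.Group) (s : S) : ρ (w * M.simple s) (simpleRoot s) = -ρ w (simpleRoot s) := by
  obtain ⟨L, hL⟩ := exists_linearMap_eq_rep hρ w
  rw [rep_mul_apply, hρ, simpleReflection_simpleRoot_self, ← hL, map_neg]

lemma rep_alternatingWord_simpleRoot (hρ : ∀ s : S, ρ (M.simple s) = simpleReflection M s)
    (s t : S) (k : ℕ) :
    ρ (M.toCoxeterSystem.wordProd (alternatingWord s t k)) (simpleRoot s) =
      if Even k then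
        dihedralCoeff (-bilinCoeff M s t) (k + 1) • simpleRoot s +
          dihedralCoeff (-bilinCoeff M s t) k • simpleRoot t
      else
        dihedralCoeff (-bilinCoeff M s t) k • simpleRoot s +
          dihedralCoeff (-bilinCoeff M s t) (k + 1) • simpleRoot t := by
  induction k with
  | zero =>
    simp only [alternatingWord, wordProd_nil, map_one, Even.zero, if_true, dihedralCoeff]
    simp [Function.End.one_def]
  | succ k ih =>
    rw [alternatingWord_succ', wordProd_cons, rep_mul_apply, ih,
      CoxeterMatrix.toCoxeterSystem_simple, hρ, ← coe_simpleReflectionLinear]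
    by_cases hk : Even k
    · simp only [hk, if_true, map_add, map_smul, coe_simpleReflectionLinear,
        simpleReflection_simpleRoot_self, simpleReflection_simpleRoot, Nat.even_add_one,
        not_true, if_false, dihedralCoeff]
      module
    · simp only [hk, if_false, map_add, map_smul, coe_simpleReflectionLinear,
        simpleReflection_simpleRoot_self, simpleReflection_simpleRoot, Nat.even_add_one,
        not_false_eq_true, if_true, dihedralCoeff, bilinCoeff_comm M t s]
      module

lemma rep_simpleRoot_nonneg (hρ : ∀ s : S, ρ (M.simple s) = simpleReflection M s)
    (w : M.Group) (s : S) (hs : ¬M.toCoxeterSystem.IsRightDescent w s) :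
    0 ≤ ρ w (simpleRoot s) := by
  induction hn : M.toCoxeterSystem.length w using Nat.strong_induction_on generalizing w s with
  | _ n ih =>
    set cs := M.toCoxeterSystem with hcs
    by_cases hw : w = 1
    · subst hw
      rw [map_one]
      exact Pi.single_nonneg.2 zero_le_one
    obtain ⟨t, ht⟩ := cs.exists_rightDescent_of_ne_one hw
    have hst : s ≠ t := by
      rintro rfl
      exact hs ht
    obtain ⟨v, k, hv, hl, hvs, hvt⟩ := cs.exists_eq_mul_alternatingWord s t w hs
    have hk : k ≠ 0 := by
      rintro rfl
      simp only [alternatingWord, wordProd_nil, mul_one] at hv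
      exact hvt (hv ▸ ht)
    have hred : M s t ≠ 0 → k + 1 ≤ M s t := by
      intro h0
      by_contra! hlt
      rw [M.symmetric s t] at h0 hlt
      refine cs.not_isReduced_alternatingWord t s h0 hlt ?_
      have h₁ := cs.not_isRightDescent_iff.1 hs
      have h₂ := cs.length_wordProd_le (alternatingWord t s (k + 1))
      have h₃ := cs.length_mul_le v (cs.wordProd (alternatingWord t s (k + 1)))
      have h₄ : w * cs.simple s = v * cs.wordProd (alternatingWord t s (k + 1)) := by
        rw [alternatingWord_succ, wordProd_concat, ← mul_assoc, ← hv]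
      rw [← h₄] at h₃
      rw [length_alternatingWord] at h₂
      rw [CoxeterSystem.IsReduced, length_alternatingWord]
      lia
    have hc₁ := dihedralCoeff_nonneg M hst hred
    have hc₀ := dihedralCoeff_nonneg M hst fun h => (Nat.le_succ k).trans (hred h)
    have hps := ih _ (by lia) v s hvs rfl
    have hpt := ih _ (by lia) v t hvt rfl
    obtain ⟨L, hL⟩ := exists_linearMap_eq_rep hρ v
    rw [hv, rep_mul_apply, rep_alternatingWord_simpleRoot hρ]
    rw [← hL] at hps hpt ⊢
    split_ifs
    · rw [map_add, map_smul, map_smul]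
      exact add_nonneg (smul_nonneg hc₁ hps) (smul_nonneg hc₀ hpt)
    · rw [map_add, map_smul, map_smul]
      exact add_nonneg (smul_nonneg hc₀ hps) (smul_nonneg hc₁ hpt)

lemma rep_simpleRoot_nonneg_or_nonpos (hρ : ∀ s : S, ρ (M.simple s) = simpleReflection M s)
    (w : M.Group) (s : S) : 0 ≤ ρ w (simpleRoot s) ∨ ρ w (simpleRoot s) ≤ 0 := by
  by_cases hs : M.toCoxeterSystem.IsRightDescent w s
  · right
    have := rep_simpleRoot_nonneg hρ _ s
      (M.toCoxeterSystem.isRightDescent_iff_not_isRightDescent_mul.1 hs)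
    rwa [CoxeterMatrix.toCoxeterSystem_simple, rep_mul_simple_simpleRoot hρ, neg_nonneg] at this
  · exact Or.inl (rep_simpleRoot_nonneg hρ w s hs)

lemma rep_apply_of_notMem (hρ : ∀ s : S, ρ (M.simple s) = simpleReflection M s) {X : Set S}
    {u : M.Group} (hu : u ∈ Subgroup.closure (M.simple '' X)) {s : S} (hs : s ∉ X) (v : S → ℝ) :
    ρ u v s = v s := by
  induction hu using Subgroup.closure_induction generalizing v with
  | mem _ h =>
    obtain ⟨x, hx, rfl⟩ := h
    rw [hρ, simpleReflection_apply_of_ne]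
    rintro rfl
    exact hs hx
  | one => rw [map_one]; rfl
  | mul _ _ _ _ h₁ h₂ => rw [rep_mul_apply, h₁, h₂]
  | inv w _ h => exact (h (ρ w⁻¹ v)).symm.trans (congrFun (rep_apply_rep_inv w v) s)

/-- If `v` is a minimal left coset representative for the parabolic subgroup of `X`, then the only
roots of the form `v α_s` in the span of `X` are simple roots. -/
lemma exists_simpleRoot_eq_rep (hρ : ∀ s : S, ρ (M.simple s) = simpleReflection M s) {X : Set S}
    {v : M.Group} (hv : ∀ x ∈ X, ¬M.toCoxeterSystem.IsLeftDescent v x) {s : S}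
    (hs : ∀ r ∉ X, ρ v (simpleRoot s) r = 0) : ∃ x ∈ X, simpleRoot x = ρ v (simpleRoot s) := by
  have ha : ∀ x ∈ X, 0 ≤ ρ v⁻¹ (simpleRoot x) := fun x hx =>
    rep_simpleRoot_nonneg hρ _ _ ((M.toCoxeterSystem.isRightDescent_inv_iff).not.2 (hv x hx))
  obtain ⟨L, hL⟩ := exists_linearMap_eq_rep hρ v⁻¹
  set γ := ρ v (simpleRoot s) with hγ
  have hsum : ∀ r, ∑ x, γ x * ρ v⁻¹ (simpleRoot x) r = (simpleRoot s : S → ℝ) r := by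
    intro r
    have h₁ : γ = ∑ x, γ x • (simpleRoot x : S → ℝ) := by
      funext r
      simp [simpleRoot, Pi.single_apply]
    have h₂ : ρ v⁻¹ γ = simpleRoot s := rep_inv_apply_rep _ _
    rw [← h₂, ← hL]
    conv_rhs => rw [h₁]
    simp [Finset.sum_apply]
  have hss : (simpleRoot s : S → ℝ) s = 1 := by simp [simpleRoot]
  rcases rep_simpleRoot_nonneg_or_nonpos hρ v s with hpos | hneg
  · have hterm : ∀ r x, 0 ≤ γ x * ρ v⁻¹ (simpleRoot x) r := by
      intro r x
      by_cases hx : x ∈ X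
      · exact mul_nonneg (hpos x) (ha x hx r)
      · rw [hs x hx, zero_mul]
    obtain ⟨x, -, hx⟩ := Finset.exists_ne_zero_of_sum_ne_zero
      (by rw [hsum s, hss]; exact one_ne_zero :
        ∑ x, γ x * ρ v⁻¹ (simpleRoot x) s ≠ 0)
    have hγx : γ x ≠ 0 := left_ne_zero_of_mul hx
    have hxX : x ∈ X := by
      by_contra h
      exact hγx (hs x h)
    have hmul : ρ v⁻¹ (simpleRoot x) = ρ v⁻¹ (simpleRoot x) s • simpleRoot s := by
      funext r
      by_cases hr : r = s
      · subst hr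
        simp [simpleRoot]
      · have h0 : ∑ x, γ x * ρ v⁻¹ (simpleRoot x) r = 0 := by
          rw [hsum]
          simp [simpleRoot, hr]
        have := (Finset.sum_eq_zero_iff_of_nonneg fun x _ => hterm r x).1 h0 x (Finset.mem_univ x)
        simpa [simpleRoot, hr] using (mul_eq_zero.1 this).resolve_left hγx
    have hnorm := canonicalBilin_rep_self hρ v⁻¹ (simpleRoot x)
    have hc : 0 ≤ ρ v⁻¹ (simpleRoot x) s := ha x hxX s
    generalize ρ v⁻¹ (simpleRoot x) s = c at hmul hc
    have hone : c = 1 := by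
      simp only [hmul, map_smul, LinearMap.smul_apply, canonicalBilin_simpleRoot,
        bilinCoeff_self, smul_eq_mul] at hnorm
      nlinarith
    refine ⟨x, hxX, ?_⟩
    rw [hγ, ← rep_apply_rep_inv (ρ := ρ) v (simpleRoot x), hmul, hone, one_smul]
  · exfalso
    have : ∑ x, γ x * ρ v⁻¹ (simpleRoot x) s ≤ 0 := by
      refine Finset.sum_nonpos fun x _ => ?_
      by_cases hx : x ∈ X
      · exact mul_nonpos_of_nonpos_of_nonneg (hneg x) (ha x hx s)
      · rw [hs x hx, zero_mul]
    rw [hsum, hss] at this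
    linarith

end Representation


/-- **Lemma 3.5.** `Φ[Γ_X] = V_X ∩ Φ[Γ]`: a root of `Φ[Γ]` lies in the root system of `Γ_X`
if and only if it lies in the subspace `V_X` spanned by `{α_x | x ∈ X}`. Here `ρ` is the
canonical representation of `W[Γ]`, determined by `ρ (simple s) = simpleReflection M s`. -/
theorem coxeter_roots_of_parabolic {S : Type*} [Fintype S] [DecidableEq S]
    (M : CoxeterMatrix S) (X : Set S)
    (ρ : M.Group →* Function.End (S → ℝ))
    (hρ : ∀ s : S, ρ (M.simple s) = simpleReflection M s) :
    {v : S → ℝ | ∃ u ∈ Subgroup.closure (M.simple '' X), ∃ x ∈ X, ρ u (simpleRoot x) = v} =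
      {v : S → ℝ | (∀ s, s ∉ X → v s = 0) ∧ ∃ w : M.Group, ∃ s : S, ρ w (simpleRoot s) = v} := by
  ext β
  constructor
  · rintro ⟨u, hu, x, hx, rfl⟩
    refine ⟨fun s hs => ?_, u, x, rfl⟩
    rw [rep_apply_of_notMem hρ hu hs, simpleRoot, Pi.single_eq_of_ne]
    rintro rfl
    exact hs hx
  · rintro ⟨hβ, w, s, rfl⟩
    obtain ⟨u, hu, v, rfl, hv⟩ := M.toCoxeterSystem.exists_eq_parabolic_mul X w
    have hs : ∀ r ∉ X, ρ v (simpleRoot s) r = 0 := by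
      intro r hr
      rw [← hβ r hr, rep_mul_apply, rep_apply_of_notMem hρ hu hr]
    obtain ⟨x, hx, h⟩ := exists_simpleRoot_eq_rep hρ hv hs
    exact ⟨u, hu, x, hx, by rw [h, rep_mul_apply]⟩
end
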